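/- Let k ∈ ℕ, let b ∈ ℝ with b > 2 − k, let λ ∈ ℝ satisfy λ ≤ (k−2+b)²/4 + b, and let h : ℝ → ℝ be continuously differentiable on (0,∞) with t·h'(t) ≥ b for all t > 0. Then for every continuously differentiable function ξ : ℝ → ℝ with compact support contained in (0,∞), ∫₀^∞ ( ξ'(r)² − λ·ξ(r)²/r² + h'(r)·ξ(r)²/r ) r^{k−1} e^{h(r)} dr ≥ 0. -/

import Mathlib

open MeasureTheory

/-- A function that is `C^n` on an open set, times a `C^n` function supported in that set,
is `C^n`. -/
theorem contDiff_mul_of_tsupport_subset {f g : ℝ → ℝ} {s : Set ℝ} {n : WithTop ℕ∞}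
    (hs : IsOpen s) (hf : ContDiff ℝ n f) (hg : ContDiffOn ℝ n g s) (hfs : tsupport f ⊆ s) :
    ContDiff ℝ n (fun x => f x * g x) := by
  rw [contDiff_iff_contDiffAt]
  intro x
  by_cases hx : x ∈ tsupport f
  · exact hf.contDiffAt.mul (hg.contDiffAt (hs.mem_nhds (hfs hx)))
  · refine (contDiffAt_const (c := (0 : ℝ))).congr_of_eventuallyEq ?_
    filter_upwards [notMem_tsupport_iff_eventuallyEq.mp hx] with y hy
    simp [hy]

/-- Hardy's inequality before integration: the stability integrand dominates minus the
derivative of `c ξ² r^{k-2} e^h`, where `x = ξ`, `y = ξ'`, `d = h'` and `w = r^{k-1} e^h`. -/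
theorem neg_le_stability_integrand {k b lam r d x y w c : ℝ} (hr : 0 < r) (hw : 0 ≤ w)
    (hc : c = (k - 2 + b) / 2) (hc0 : 0 < c) (hlam : lam ≤ (k - 2 + b) ^ 2 / 4 + b)
    (hd : b ≤ r * d) :
    -(c * (2 * x * y / r + x ^ 2 * ((k - 2) / r ^ 2 + d / r)) * w) ≤
      (y ^ 2 - lam * x ^ 2 / r ^ 2 + d * x ^ 2 / r) * w := by
  have hlam' : 0 ≤ (r * d - b) * (1 + c) + (c ^ 2 + b - lam) := by
    have h₁ : 0 ≤ (r * d - b) * (1 + c) := mul_nonneg (by linarith) (by linarith)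
    have h₂ : c ^ 2 = (k - 2 + b) ^ 2 / 4 := by rw [hc]; ring
    linarith
  have hk : k = 2 * c - b + 2 := by rw [hc]; ring
  have key : (y ^ 2 - lam * x ^ 2 / r ^ 2 + d * x ^ 2 / r) * w +
      c * (2 * x * y / r + x ^ 2 * ((k - 2) / r ^ 2 + d / r)) * w =
      ((y + c * x / r) ^ 2 +
        ((r * d - b) * (1 + c) + (c ^ 2 + b - lam)) * (x / r) ^ 2) * w := by
    rw [hk]
    field_simp
    ring
  have : 0 ≤ ((y + c * x / r) ^ 2 +
        ((r * d - b) * (1 + c) + (c ^ 2 + b - lam)) * (x / r) ^ 2) * w := by positivity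
  linarith

/-- Radial form of the `f`-stability inequality for `k`-dimensional minimal cones with
density `e^{h(|x|)}`: if `t h'(t) ≥ b > 2 − k` on `(0,∞)` and `λ ≤ (k−2+b)²/4 + b`, then
`∫₀^∞ ((ξ')² − λ ξ²/r² + h'(r) ξ²/r) r^{k−1} e^{h} dr ≥ 0` for every `C¹` function `ξ`
compactly supported in `(0,∞)`. -/
theorem radial_f_stability (k : ℕ) (b lam : ℝ) (hb : b > 2 - (k : ℝ))
    (hlam : lam ≤ ((k : ℝ) - 2 + b) ^ 2 / 4 + b)
    (h : ℝ → ℝ) (hh : ContDiffOn ℝ 1 h (Set.Ioi 0))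
    (hb' : ∀ t > (0 : ℝ), t * deriv h t ≥ b)
    (ξ : ℝ → ℝ) (hξ : ContDiff ℝ 1 ξ) (hcs : HasCompactSupport ξ)
    (hsupp : tsupport ξ ⊆ Set.Ioi 0) :
    0 ≤ ∫ r in Set.Ioi (0 : ℝ),
        ((deriv ξ r) ^ 2 - lam * ξ r ^ 2 / r ^ 2 + deriv h r * ξ r ^ 2 / r) *
          r ^ ((k : ℝ) - 1) * Real.exp (h r) := by
  set c : ℝ := ((k : ℝ) - 2 + b) / 2 with hc
  have hc0 : 0 < c := by rw [hc]; linarith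
  set g : ℝ → ℝ := fun r => r ^ ((k : ℝ) - 2) * Real.exp (h r) with hg
  set F : ℝ → ℝ := fun r => (c * ξ r ^ 2) * g r with hF
  have hgd : ContDiffOn ℝ 1 g (Set.Ioi 0) := by
    refine ContDiffOn.mul (fun x hx => ?_) hh.exp
    exact (Real.contDiffAt_rpow_const_of_ne (ne_of_gt hx)).contDiffWithinAt
  have hsub : tsupport (fun r => c * ξ r ^ 2) ⊆ tsupport ξ := by
    refine closure_mono fun x hx hx0 => hx ?_
    simp [hx0]
  have hFd : ContDiff ℝ 1 F :=
    contDiff_mul_of_tsupport_subset isOpen_Ioi (contDiff_const.mul (hξ.pow 2)) hgd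
      (hsub.trans hsupp)
  have hFc : HasCompactSupport F := by
    refine hcs.mono fun x hx hx0 => hx ?_
    simp [hF, hx0]
  have hF0 : F 0 = 0 := by
    have : ξ 0 = 0 := image_eq_zero_of_notMem_tsupport fun h0 => lt_irrefl (0 : ℝ) (hsupp h0)
    simp [hF, this]
  have hint : ∫ r in Set.Ioi (0 : ℝ), -deriv F r = 0 := by
    rw [integral_neg, hFc.integral_Ioi_deriv_eq hFd, hF0]
    simp
  have hFi : IntegrableOn (fun r => -deriv F r) (Set.Ioi 0) :=
    (((hFd.continuous_deriv le_rfl).integrable_of_hasCompactSupport hFc.deriv).neg).integrableOn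
  by_cases hI : IntegrableOn (fun r => ((deriv ξ r) ^ 2 - lam * ξ r ^ 2 / r ^ 2 +
      deriv h r * ξ r ^ 2 / r) * r ^ ((k : ℝ) - 1) * Real.exp (h r)) (Set.Ioi 0)
  swap
  · exact (integral_undef hI).ge
  refine hint.ge.trans ?_
  refine setIntegral_mono_on hFi hI measurableSet_Ioi fun r hr => ?_
  have hr : 0 < r := hr
  have hhr : HasDerivAt h (deriv h r) r :=
    ((hh.contDiffAt (Ioi_mem_nhds hr)).differentiableAt one_ne_zero).hasDerivAt
  have hξr : HasDerivAt ξ (deriv ξ r) r :=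
    (hξ.differentiable one_ne_zero r).hasDerivAt
  have hFr := ((hξr.pow 2).const_mul c).mul
    ((Real.hasDerivAt_rpow_const (p := (k : ℝ) - 2) (Or.inl hr.ne')).mul hhr.exp)
  have h₁ : r ^ ((k : ℝ) - 2) = r ^ ((k : ℝ) - 1) / r := by
    rw [← Real.rpow_sub_one hr.ne']; ring_nf
  have h₂ : r ^ ((k : ℝ) - 2 - 1) = r ^ ((k : ℝ) - 1) / r ^ 2 := by
    rw [Real.rpow_sub_one hr.ne', h₁]; field_simp
  have hderiv : deriv F r = c * (2 * ξ r * deriv ξ r / r +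
      ξ r ^ 2 * (((k : ℝ) - 2) / r ^ 2 + deriv h r / r)) *
        (r ^ ((k : ℝ) - 1) * Real.exp (h r)) := by
    refine (HasDerivAt.deriv hFr).trans ?_
    simp only [Pi.mul_apply, Pi.pow_apply, h₁, h₂]
    field_simp
    push_cast
    ring
  rw [hderiv, mul_assoc _ (r ^ ((k : ℝ) - 1))]
  exact neg_le_stability_integrand hr (by positivity) hc hc0 hlam (hb' r hr)
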